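/- Let (M, D = ker α∧β) be an Engel structure and X = M × ℝ with coordinate s on the ℝ-factor. Then η = β + sα is a contact form on X. Moreover, for any other choice of Engel defining forms α̃ = λα and β̃ = να + μβ (λ, μ nowhere vanishing), there is a contactomorphism ψ : (X, ker η) → (X, ker η̃) of the form ψ(p,s) = (p, f(p)s + g(p)), where f, g ∈ C^∞(M) and f is nowhere vanishing; explicitly ψ(p,s) = (p, (μ(p)s − ν(p))/λ(p)) satisfies ψ*η̃ = μη. -/

import Mathlib

noncomputable section

open Manifold Module Function Set

variable {E : Type*} [NormedAddCommGroup E] [NormedSpace ℝ E]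
  {H : Type*} [TopologicalSpace H]

/-- The type of (not necessarily smooth) vector fields on a manifold. -/
abbrev VF (I : ModelWithCorners ℝ E H) (M : Type*) [TopologicalSpace M] [ChartedSpace H M] :=
  ∀ x : M, TangentSpace I x

/-- A vector field is smooth if the corresponding section of the tangent bundle is smooth. -/
def SmoothVF (I : ModelWithCorners ℝ E H) {M : Type*} [TopologicalSpace M] [ChartedSpace H M]
    [IsManifold I (⊤ : ℕ∞) M] (V : VF I M) : Prop :=
  ContMDiff I I.tangent (⊤ : ℕ∞) (fun x => (⟨x, V x⟩ : TangentBundle I M))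

/-- A smooth real valued function on a manifold. -/
def SmoothFn (I : ModelWithCorners ℝ E H) {M : Type*} [TopologicalSpace M] [ChartedSpace H M]
    [IsManifold I (⊤ : ℕ∞) M] (f : M → ℝ) : Prop :=
  ContMDiff I 𝓘(ℝ) (⊤ : ℕ∞) f

/-- Derivative of a real valued function along a vector field. -/
def vderiv (I : ModelWithCorners ℝ E H) {M : Type*} [TopologicalSpace M] [ChartedSpace H M]
    [IsManifold I (⊤ : ℕ∞) M] (V : VF I M) (f : M → ℝ) : M → ℝ :=
  fun x => mfderiv I 𝓘(ℝ) f x (V x)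

/-- The Lie bracket of two vector fields on a manifold, defined by transporting the two
vector fields to the model space via the preferred chart at the given point, taking the
Lie bracket of vector fields there, and transporting the result back.  For smooth vector
fields this is the usual Lie bracket `[V, W]`. -/
def vfLie (I : ModelWithCorners ℝ E H) {M : Type*} [TopologicalSpace M] [ChartedSpace H M]
    [IsManifold I (⊤ : ℕ∞) M] (V W : VF I M) : VF I M := fun x₀ =>
  mfderiv 𝓘(ℝ, E) I (extChartAt I x₀).symm (extChartAt I x₀ x₀)
    ((VectorField.lieBracket ℝ
      (fun e => (mfderiv I 𝓘(ℝ, E) (extChartAt I x₀) ((extChartAt I x₀).symm e)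
        (V ((extChartAt I x₀).symm e)) : E))
      (fun e => (mfderiv I 𝓘(ℝ, E) (extChartAt I x₀) ((extChartAt I x₀).symm e)
        (W ((extChartAt I x₀).symm e)) : E))
      (extChartAt I x₀ x₀) : E))

/-- A smooth differential `1`-form on a manifold, given by its pointwise values. -/
structure OneForm (I : ModelWithCorners ℝ E H) (M : Type*) [TopologicalSpace M]
    [ChartedSpace H M] [IsManifold I (⊤ : ℕ∞) M] where
  val : ∀ x : M, TangentSpace I x →ₗ[ℝ] ℝ
  smooth' : ∀ V : VF I M, SmoothVF I V → SmoothFn I (fun x => val x (V x))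

/-- A smooth differential `k`-form on a manifold, given by its pointwise values. -/
structure FormPt (I : ModelWithCorners ℝ E H) (M : Type*) [TopologicalSpace M]
    [ChartedSpace H M] [IsManifold I (⊤ : ℕ∞) M] (k : ℕ) where
  val : ∀ x : M, (TangentSpace I x) [⋀^Fin k]→ₗ[ℝ] ℝ
  smooth' : ∀ V : Fin k → VF I M, (∀ i, SmoothVF I (V i)) →
    SmoothFn I (fun x => val x (fun i => V i x))

variable {I : ModelWithCorners ℝ E H} {M : Type*} [TopologicalSpace M] [ChartedSpace H M]
  [IsManifold I (⊤ : ℕ∞) M]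

/-- The exterior derivative of a (pointwise defined) `1`-form, evaluated on two vector
fields, via the Cartan formula `dω(V,W) = V (ω W) - W (ω V) - ω [V,W]`.  Here the `1`-form
is given as a function on vector fields. -/
def dOfFun (I : ModelWithCorners ℝ E H) {M : Type*} [TopologicalSpace M] [ChartedSpace H M]
    [IsManifold I (⊤ : ℕ∞) M] (lam : VF I M → M → ℝ) (V W : VF I M) : M → ℝ :=
  fun x => vderiv I V (lam W) x - vderiv I W (lam V) x - lam (vfLie I V W) x

/-- The exterior derivative of a `1`-form, as a function of two vector fields. -/
def OneForm.d (ω : OneForm I M) (V W : VF I M) : M → ℝ :=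
  dOfFun I (fun U x => ω.val x (U x)) V W

/-- A distribution (field of tangent subspaces) on a manifold. -/
abbrev TangentDist (I : ModelWithCorners ℝ E H) (M : Type*) [TopologicalSpace M] [ChartedSpace H M] :=
  ∀ x : M, Submodule ℝ (TangentSpace I x)

/-- A (smooth) section of a distribution. -/
def IsSection (I : ModelWithCorners ℝ E H) {M : Type*} [TopologicalSpace M] [ChartedSpace H M]
    [IsManifold I (⊤ : ℕ∞) M] (D : TangentDist I M) (V : VF I M) : Prop :=
  SmoothVF I V ∧ ∀ x, V x ∈ D x

/-- The distribution `[D, D]` generated by a distribution `D` together with all Lie brackets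
of its sections. -/
def derivedDist (I : ModelWithCorners ℝ E H) {M : Type*} [TopologicalSpace M] [ChartedSpace H M]
    [IsManifold I (⊤ : ℕ∞) M] (D : TangentDist I M) : TangentDist I M := fun x =>
  Submodule.span ℝ
    ({v | ∃ V, IsSection I D V ∧ V x = v} ∪
     {v | ∃ V W, IsSection I D V ∧ IsSection I D W ∧ vfLie I V W x = v})

/-- A distribution is integrable (in the sense of Frobenius: involutive) if Lie brackets of
its sections are again tangent to it. -/
def IsIntegrableDist (I : ModelWithCorners ℝ E H) {M : Type*} [TopologicalSpace M]
    [ChartedSpace H M] [IsManifold I (⊤ : ℕ∞) M] (D : TangentDist I M) : Prop :=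
  ∀ V W, IsSection I D V → IsSection I D W → ∀ x, vfLie I V W x ∈ D x

/-- `(ω ∧ θ)(U,V,W)` for a `1`-form `ω` and a `2`-form `θ` given as a function of two
vector fields. -/
def wedge1_2 (I : ModelWithCorners ℝ E H) {M : Type*} [TopologicalSpace M] [ChartedSpace H M]
    [IsManifold I (⊤ : ℕ∞) M] (ω : OneForm I M) (θ : VF I M → VF I M → M → ℝ)
    (U V W : VF I M) : M → ℝ := fun x =>
  ω.val x (U x) * θ V W x - ω.val x (V x) * θ U W x + ω.val x (W x) * θ U V x

/-- The square `θ ∧ θ` of a `2`-form `θ` (given as a function of two vector fields) vanishes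
identically. -/
def FormSqZero (I : ModelWithCorners ℝ E H) {M : Type*} [TopologicalSpace M] [ChartedSpace H M]
    [IsManifold I (⊤ : ℕ∞) M] (θ : VF I M → VF I M → M → ℝ) : Prop :=
  ∀ V₀ V₁ V₂ V₃ : VF I M, SmoothVF I V₀ → SmoothVF I V₁ → SmoothVF I V₂ → SmoothVF I V₃ →
    ∀ x, θ V₀ V₁ x * θ V₂ V₃ x - θ V₀ V₂ x * θ V₁ V₃ x + θ V₀ V₃ x * θ V₁ V₂ x = 0

/-- An Engel structure: a rank 2 distribution `D` such that `E := [D,D]` has rank 3 and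
`[E,E] = TM`. -/
def IsEngel (I : ModelWithCorners ℝ E H) {M : Type*} [TopologicalSpace M] [ChartedSpace H M]
    [IsManifold I (⊤ : ℕ∞) M] (D : TangentDist I M) : Prop :=
  (∀ x, Module.finrank ℝ (D x) = 2) ∧ (∀ x, Module.finrank ℝ (derivedDist I D x) = 3) ∧
  (∀ x, derivedDist I (derivedDist I D) x = ⊤)

/-- Engel defining forms: `D = ker α ∩ ker β` and `E = [D,D] = ker α`. -/
def EngelDefiningForms (I : ModelWithCorners ℝ E H) {M : Type*} [TopologicalSpace M]
    [ChartedSpace H M] [IsManifold I (⊤ : ℕ∞) M] (D : TangentDist I M)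
    (α β : OneForm I M) : Prop :=
  (∀ x, D x = LinearMap.ker (α.val x) ⊓ LinearMap.ker (β.val x)) ∧
  (∀ x, derivedDist I D x = LinearMap.ker (α.val x))

/-- The pair of Reeb vector fields `T`, `R` associated with Engel defining forms `α`, `β`:
`i_T(α ∧ dβ) = 0`, `β(T) = 1`, `α(T) = 0`, `i_R(β ∧ dβ) = 0`, `β(R) = 0`, `α(R) = 1`. -/
structure IsReebPair (I : ModelWithCorners ℝ E H) {M : Type*} [TopologicalSpace M]
    [ChartedSpace H M] [IsManifold I (⊤ : ℕ∞) M] (α β : OneForm I M)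
    (T R : VF I M) : Prop where
  smoothT : SmoothVF I T
  smoothR : SmoothVF I R
  alphaT : ∀ x, α.val x (T x) = 0
  betaT : ∀ x, β.val x (T x) = 1
  alphaR : ∀ x, α.val x (R x) = 1
  betaR : ∀ x, β.val x (R x) = 0
  insT : ∀ V W, SmoothVF I V → SmoothVF I W → ∀ x, wedge1_2 I α β.d T V W x = 0
  insR : ∀ V W, SmoothVF I V → SmoothVF I W → ∀ x, wedge1_2 I β β.d R V W x = 0

/-- The Reeb distribution spanned by the two Reeb vector fields. -/
def reebDist (I : ModelWithCorners ℝ E H) {M : Type*} [TopologicalSpace M] [ChartedSpace H M]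
    (T R : VF I M) : TangentDist I M := fun x => Submodule.span ℝ {T x, R x}

/-- `W` is a nonsingular vector field spanning the characteristic foliation of the even
contact structure `E = [D,D]`:  `W` is tangent to `D` and `[W, E] ⊆ E`. -/
def SpansChar (I : ModelWithCorners ℝ E H) {M : Type*} [TopologicalSpace M] [ChartedSpace H M]
    [IsManifold I (⊤ : ℕ∞) M] (D : TangentDist I M) (W : VF I M) : Prop :=
  SmoothVF I W ∧ (∀ x, W x ≠ 0) ∧ (∀ x, W x ∈ D x) ∧
  ∀ V, IsSection I (derivedDist I D) V → ∀ x, vfLie I W V x ∈ derivedDist I D x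

/-- A Riemannian metric, given by its pointwise values. -/
structure RMetric (I : ModelWithCorners ℝ E H) (M : Type*) [TopologicalSpace M]
    [ChartedSpace H M] [IsManifold I (⊤ : ℕ∞) M] where
  val : ∀ x : M, TangentSpace I x →ₗ[ℝ] TangentSpace I x →ₗ[ℝ] ℝ
  symm : ∀ x u v, val x u v = val x v u
  posdef : ∀ x v, v ≠ 0 → 0 < val x v v
  smooth' : ∀ V W, SmoothVF I V → SmoothVF I W → SmoothFn I (fun x => val x (V x) (W x))

/-- The Koszul formula: `koszul g X Y Z = g(∇_X Y, Z)` where `∇` is the Levi-Civita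
connection of `g`. -/
def koszul (I : ModelWithCorners ℝ E H) {M : Type*} [TopologicalSpace M] [ChartedSpace H M]
    [IsManifold I (⊤ : ℕ∞) M] (g : RMetric I M) (X Y Z : VF I M) : M → ℝ := fun x =>
  (vderiv I X (fun y => g.val y (Y y) (Z y)) x + vderiv I Y (fun y => g.val y (X y) (Z y)) x
    - vderiv I Z (fun y => g.val y (X y) (Y y)) x
    + g.val x (vfLie I X Y x) (Z x) - g.val x (vfLie I X Z x) (Y x)
    - g.val x (vfLie I Y Z x) (X x)) / 2

/-- A distribution `D` is totally geodesic for `g` iff every geodesic tangent to it at one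
point stays tangent to it; equivalently (the standard characterization, which we take as the
definition) `∇_U U` is tangent to `D` for every section `U` of `D`, i.e. `g(∇_U U, V) = 0`
for every vector field `V` orthogonal to `D`. -/
def IsTotallyGeodesic (I : ModelWithCorners ℝ E H) {M : Type*} [TopologicalSpace M]
    [ChartedSpace H M] [IsManifold I (⊤ : ℕ∞) M] (g : RMetric I M)
    (D : TangentDist I M) : Prop :=
  ∀ U, IsSection I D U → ∀ V, SmoothVF I V → (∀ x, ∀ u ∈ D x, g.val x (V x) u = 0) →
    ∀ x, koszul I g U U V x = 0

/-- A Killing vector field: `L_Z g = 0`, expressed on vector fields. -/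
def IsKilling (I : ModelWithCorners ℝ E H) {M : Type*} [TopologicalSpace M] [ChartedSpace H M]
    [IsManifold I (⊤ : ℕ∞) M] (g : RMetric I M) (Z : VF I M) : Prop :=
  ∀ V W, SmoothVF I V → SmoothVF I W → ∀ x,
    vderiv I Z (fun y => g.val y (V y) (W y)) x
      = g.val x (vfLie I Z V x) (W x) + g.val x (V x) (vfLie I Z W x)

/-- An Engel vector field: the flow of `Z` preserves `D`, i.e. `L_Z D ⊆ D`. -/
def IsEngelVF (I : ModelWithCorners ℝ E H) {M : Type*} [TopologicalSpace M] [ChartedSpace H M]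
    [IsManifold I (⊤ : ℕ∞) M] (D : TangentDist I M) (Z : VF I M) : Prop :=
  SmoothVF I Z ∧ ∀ V, IsSection I D V → ∀ x, vfLie I Z V x ∈ D x

/-- A K-Engel structure: `D` is an Engel structure, `g` a Riemannian metric and `Z` a
(nowhere vanishing) vector field which is Engel, Killing and orthogonal to `E = [D,D]`. -/
structure IsKEngel (I : ModelWithCorners ℝ E H) {M : Type*} [TopologicalSpace M]
    [ChartedSpace H M] [IsManifold I (⊤ : ℕ∞) M] (D : TangentDist I M)
    (g : RMetric I M) (Z : VF I M) : Prop where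
  engel : IsEngel I D
  engelVF : IsEngelVF I D Z
  killing : IsKilling I g Z
  orth : ∀ x, ∀ v ∈ derivedDist I D x, g.val x (Z x) v = 0
  nonzero : ∀ x, Z x ≠ 0

/-- A `1`-form is closed. -/
def OneForm.IsClosed {I : ModelWithCorners ℝ E H} {M : Type*} [TopologicalSpace M]
    [ChartedSpace H M] [IsManifold I (⊤ : ℕ∞) M] (ω : OneForm I M) : Prop :=
  ∀ V W, SmoothVF I V → SmoothVF I W → ∀ x, ω.d V W x = 0

/-- The Lie derivative `(L_Z ω)(V) = Z (ω V) - ω [Z,V]` of a `1`-form along a vector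
field, as a function of vector fields. -/
def lieOneForm (I : ModelWithCorners ℝ E H) {M : Type*} [TopologicalSpace M] [ChartedSpace H M]
    [IsManifold I (⊤ : ℕ∞) M] (ω : OneForm I M) (Z V : VF I M) : M → ℝ := fun x =>
  vderiv I Z (fun y => ω.val y (V y)) x - ω.val x (vfLie I Z V x)

/-- The exterior derivative of a pointwise-defined `(m+1)`-form evaluated on `m+2` vector
fields, via the global Koszul formula. -/
def extDerEval (I : ModelWithCorners ℝ E H) {M : Type*} [TopologicalSpace M] [ChartedSpace H M]
    [IsManifold I (⊤ : ℕ∞) M] {m : ℕ} (ν : FormPt I M (m+1)) (V : Fin (m+2) → VF I M) :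
    M → ℝ := fun x =>
  (∑ i : Fin (m+2), (-1 : ℝ)^(i : ℕ) *
    vderiv I (V i) (fun y => ν.val y (fun l => V (i.succAbove l) y)) x)
  + ∑ i : Fin (m+2), ∑ j : Fin (m+2), if h : (i : ℕ) < (j : ℕ) then
      (-1 : ℝ)^((i : ℕ)+(j : ℕ)) * ν.val x (Fin.cons (vfLie I (V i) (V j) x)
        (fun l => V (j.succAbove ((⟨(i : ℕ), by have := j.2; omega⟩ : Fin (m+1)).succAbove l)) x))
    else 0

/-- A pointwise-defined form is closed. -/
def FormPt.IsClosedForm {I : ModelWithCorners ℝ E H} {M : Type*} [TopologicalSpace M]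
    [ChartedSpace H M] [IsManifold I (⊤ : ℕ∞) M] {m : ℕ} (ν : FormPt I M (m+1)) : Prop :=
  ∀ V : Fin (m+2) → VF I M, (∀ i, SmoothVF I (V i)) → ∀ x, extDerEval I ν V x = 0

/-- `φ : ℝ → M → M` is the flow of the vector field `Z`. -/
def IsFlowOf (I : ModelWithCorners ℝ E H) {M : Type*} [TopologicalSpace M] [ChartedSpace H M]
    [IsManifold I (⊤ : ℕ∞) M] (Z : VF I M) (φ : ℝ → M → M) : Prop :=
  Continuous (fun p : ℝ × M => φ p.1 p.2) ∧ (∀ x, φ 0 x = x) ∧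
  (∀ s t x, φ (s + t) x = φ s (φ t x)) ∧
  ∀ x t, HasMFDerivAt 𝓘(ℝ) I (fun s => φ s x) t
    ((1 : ℝ →L[ℝ] ℝ).smulRight (Z (φ t x)))

/-- `(η ∧ dη ∧ dη)(V₀,...,V₄)` up to a positive constant factor, for a pointwise `1`-form
`η`; pointwise nonvanishing of this expression on frames is the contact condition in
dimension 5. -/
def contactEval (I : ModelWithCorners ℝ E H) {M : Type*} [TopologicalSpace M] [ChartedSpace H M]
    [IsManifold I (⊤ : ℕ∞) M] (η : ∀ z : M, TangentSpace I z →ₗ[ℝ] ℝ)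
    (V : Fin 5 → VF I M) : M → ℝ := fun z =>
  ∑ σ : Equiv.Perm (Fin 5), ((Equiv.Perm.sign σ : ℤ) : ℝ) *
    (η z (V (σ 0) z) * dOfFun I (fun U x => η x (U x)) (V (σ 1)) (V (σ 2)) z *
      dOfFun I (fun U x => η x (U x)) (V (σ 3)) (V (σ 4)) z)

/-- The contactization `1`-form `η = β + s·α` on `X = M × ℝ`. -/
def contactizationForm {M : Type*} [TopologicalSpace M]
    [ChartedSpace (EuclideanSpace ℝ (Fin 4)) M] [IsManifold (𝓡 4) (⊤ : ℕ∞) M]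
    (α β : OneForm (𝓡 4) M) :
    ∀ z : M × ℝ, TangentSpace ((𝓡 4).prod 𝓘(ℝ)) z →ₗ[ℝ] ℝ := fun z =>
  (β.val z.1 + z.2 • α.val z.1).comp (LinearMap.fst ℝ (EuclideanSpace ℝ (Fin 4)) ℝ)

/-- A pointwise `1`-form on a 5-dimensional manifold is a contact form:
`η ∧ dη ∧ dη ≠ 0` everywhere. -/
def IsContactForm {E' H' : Type*} [NormedAddCommGroup E'] [NormedSpace ℝ E']
    [TopologicalSpace H'] (I : ModelWithCorners ℝ E' H') {X : Type*} [TopologicalSpace X]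
    [ChartedSpace H' X] [IsManifold I (⊤ : ℕ∞) X]
    (η : ∀ z : X, TangentSpace I z →ₗ[ℝ] ℝ) : Prop :=
  ∀ z, ∃ V : Fin 5 → VF I X, (∀ i, SmoothVF I (V i)) ∧ contactEval I η V z ≠ 0

open scoped Topology ContDiff

/-- The expression of a vector field in the preferred chart at `x₀`. -/
def chartRep (I : ModelWithCorners ℝ E H) {M : Type*} [TopologicalSpace M] [ChartedSpace H M]
    (x₀ : M) (V : VF I M) : E → E := fun e =>
  mfderiv I 𝓘(ℝ, E) (extChartAt I x₀) ((extChartAt I x₀).symm e) (V ((extChartAt I x₀).symm e))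

theorem vfLie_eq_chartRep (V W : VF I M) (x : M) :
    vfLie I V W x = mfderiv 𝓘(ℝ, E) I (extChartAt I x).symm (extChartAt I x x)
      (VectorField.lieBracket ℝ (chartRep I x V) (chartRep I x W) (extChartAt I x x) : E) := rfl

theorem vfLie_swap (V W : VF I M) (x : M) : vfLie I V W x = -vfLie I W V x := by
  rw [vfLie_eq_chartRep, vfLie_eq_chartRep, VectorField.lieBracket_swap]
  exact map_neg (mfderiv 𝓘(ℝ, E) I (extChartAt I x).symm (extChartAt I x x)) _

theorem isManifold_of_le_infty {n : WithTop ℕ∞} (hn : n ≤ ∞) : IsManifold I n M :=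
  IsManifold.of_le (n := ∞) hn

theorem chartRep_eq_mpullbackWithin (V : VF I M) (x : M) {e : E} (he : e ∈ (extChartAt I x).target) :
    VectorField.mpullbackWithin 𝓘(ℝ, E) I (extChartAt I x).symm V (range I) e
      = chartRep I x V e := by
  have : IsManifold I 1 M := isManifold_of_le_infty (by simp)
  rw [VectorField.mpullbackWithin_apply, chartRep,
    ContinuousLinearMap.inverse_eq (mfderivWithin_extChartAt_symm_comp_mfderiv_extChartAt he)
      (mfderiv_extChartAt_comp_mfderivWithin_extChartAt_symm he)]
  rfl

section Boundaryless

variable [I.Boundaryless]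

theorem chartRep_eventuallyEq (V : VF I M) (x : M) :
    VectorField.mpullbackWithin 𝓘(ℝ, E) I (extChartAt I x).symm V (range I)
      =ᶠ[𝓝 (extChartAt I x x)] chartRep I x V := by
  filter_upwards [extChartAt_target_mem_nhds (I := I) x] with e he
  exact chartRep_eq_mpullbackWithin V x he

theorem vfLie_eq_mlieBracket (V W : VF I M) : vfLie I V W = VectorField.mlieBracket I V W := by
  have : IsManifold I 1 M := isManifold_of_le_infty (by simp)
  funext x
  have h := (chartRep_eventuallyEq V x).lieBracket_vectorField_eq (𝕜 := ℝ) (chartRep_eventuallyEq W x)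
  have hinv : (mfderiv I 𝓘(ℝ, E) (extChartAt I x) x).inverse
      = mfderiv 𝓘(ℝ, E) I (extChartAt I x).symm (extChartAt I x x) := by
    have h₁ := mfderiv_extChartAt_comp_mfderivWithin_extChartAt_symm' (I := I)
      (mem_extChartAt_source (I := I) x)
    have h₂ := mfderivWithin_extChartAt_symm_comp_mfderiv_extChartAt' (I := I)
      (mem_extChartAt_source (I := I) x)
    rw [I.range_eq_univ, mfderivWithin_univ] at h₁ h₂
    exact ContinuousLinearMap.inverse_eq h₁ h₂
  rw [← VectorField.mlieBracketWithin_univ, VectorField.mlieBracketWithin_apply, hinv,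
    vfLie_eq_chartRep, ← h, preimage_univ, univ_inter, I.range_eq_univ]
  exact congrArg (mfderiv 𝓘(ℝ, E) I (extChartAt I x).symm (extChartAt I x x))
    (congrFun (VectorField.lieBracketWithin_univ (𝕜 := ℝ) (E := E)).symm _)

theorem SmoothVF.vfLie [CompleteSpace E] {V W : VF I M} (hV : SmoothVF I V) (hW : SmoothVF I W) :
    SmoothVF I (vfLie I V W) := by
  have : IsManifold I (((⊤ : ℕ∞) : WithTop ℕ∞) + 1) M := isManifold_of_le_infty (by simp)
  have : IsManifold I (minSmoothness ℝ 2) M :=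
    isManifold_of_le_infty (by simpa using ENat.LEInfty.out)
  rw [vfLie_eq_mlieBracket]
  exact ContDiff.mlieBracket_vectorField (n := ⊤) hV hW (by simp)

theorem SmoothVF.differentiableAt_chartRep [CompleteSpace E] {V : VF I M} (hV : SmoothVF I V)
    (x : M) : DifferentiableAt ℝ (chartRep I x V) (extChartAt I x x) := by
  have : IsManifold I 2 M := isManifold_of_le_infty ENat.LEInfty.out
  have h := MDifferentiableWithinAt.differentiableWithinAt_mpullbackWithin_vectorField
    (hV.mdifferentiable (by simp) x).mdifferentiableWithinAt (s := univ)
  simp only [preimage_univ, univ_inter, I.range_eq_univ] at h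
  have h' := chartRep_eventuallyEq V x
  rw [I.range_eq_univ] at h'
  exact (differentiableWithinAt_univ.1 h).congr_of_eventuallyEq h'.symm

end Boundaryless

/-- The vector field `V + c ∂ₛ` on `M × ℝ`. -/
def liftVF (V : VF I M) (c : ℝ) : VF (I.prod 𝓘(ℝ)) (M × ℝ) := fun z => ((V z.1 : E), c)

theorem SmoothVF.liftVF {V : VF I M} (hV : SmoothVF I V) (c : ℝ) :
    SmoothVF (I.prod 𝓘(ℝ)) (liftVF V c) := by
  have : IsManifold I 1 M := isManifold_of_le_infty (by simp)
  have h : ContMDiff 𝓘(ℝ) 𝓘(ℝ).tangent ∞ (fun s : ℝ => (⟨s, c⟩ : TangentBundle 𝓘(ℝ) ℝ)) :=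
    contMDiff_vectorSpace_iff_contDiff.2 contDiff_const
  exact contMDiff_equivTangentBundleProd_symm.comp
    ((hV.comp contMDiff_fst).prodMk (h.comp contMDiff_snd))

theorem smoothVF_zero : SmoothVF I (0 : VF I M) := by
  have : IsManifold I 1 M := isManifold_of_le_infty (by simp)
  exact Bundle.contMDiff_zeroSection ℝ (TangentSpace I : M → Type _)

theorem chartRep_liftVF (V : VF I M) (c : ℝ) (z : M × ℝ) {e : E × ℝ}
    (he : e.1 ∈ (extChartAt I z.1).target) :
    chartRep (I.prod 𝓘(ℝ)) z (liftVF V c) e = (chartRep I z.1 V e.1, c) := by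
  have : IsManifold I 1 M := isManifold_of_le_infty (by simp)
  have hd : MDifferentiableAt I 𝓘(ℝ, E) (extChartAt I z.1) ((extChartAt I z.1).symm e.1) :=
    mdifferentiableAt_extChartAt (by simpa using (extChartAt I z.1).map_target he)
  have h : mfderiv (I.prod 𝓘(ℝ)) 𝓘(ℝ, E × ℝ) (extChartAt (I.prod 𝓘(ℝ)) z)
      ((extChartAt I z.1).symm e.1, e.2) =
      (mfderiv I 𝓘(ℝ, E) (extChartAt I z.1) ((extChartAt I z.1).symm e.1)).prodMap
        (mfderiv 𝓘(ℝ) 𝓘(ℝ) (id : ℝ → ℝ) e.2) := by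
    have hmap : ⇑(extChartAt (I.prod 𝓘(ℝ)) z) = Prod.map (extChartAt I z.1) id := by
      rw [extChartAt_prod]; rfl
    rw [hmap, modelWithCornersSelf_prod, ← chartedSpaceSelf_prod]
    exact mfderiv_prodMap (p := ((extChartAt I z.1).symm e.1, e.2)) hd
      (mdifferentiableAt_id (I := 𝓘(ℝ)))
  unfold chartRep
  have hs : (extChartAt (I.prod 𝓘(ℝ)) z).symm e = ((extChartAt I z.1).symm e.1, e.2) := by
    rw [extChartAt_prod]; rfl
  rw [hs, h, mfderiv_id]
  rfl

theorem lieBracket_prodMk_const {V W : E → E} {e : E × ℝ} (a b : ℝ) (hV : DifferentiableAt ℝ V e.1)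
    (hW : DifferentiableAt ℝ W e.1) :
    VectorField.lieBracket ℝ (fun p : E × ℝ => (V p.1, a)) (fun p => (W p.1, b)) e
      = (VectorField.lieBracket ℝ V W e.1, 0) := by
  have key {U : E → E} (c : ℝ) (hU : DifferentiableAt ℝ U e.1) :
      HasFDerivAt (fun p : E × ℝ => (U p.1, c))
        (((fderiv ℝ U e.1).comp (ContinuousLinearMap.fst ℝ E ℝ)).prod 0) e :=
    (hU.hasFDerivAt.comp e hasFDerivAt_fst).prodMk (hasFDerivAt_const c e)
  simp [VectorField.lieBracket, (key a hV).fderiv, (key b hW).fderiv]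

theorem mfderiv_extChartAt_symm_prod_fst [I.Boundaryless] (z : M × ℝ) (v : E × ℝ) :
    (mfderiv 𝓘(ℝ, E × ℝ) (I.prod 𝓘(ℝ)) (extChartAt (I.prod 𝓘(ℝ)) z).symm
      (extChartAt (I.prod 𝓘(ℝ)) z z) v : E × ℝ).1 =
    mfderiv 𝓘(ℝ, E) I (extChartAt I z.1).symm (extChartAt I z.1 z.1) v.1 := by
  have : IsManifold I 1 M := isManifold_of_le_infty (by simp)
  have hd : MDifferentiableAt 𝓘(ℝ, E) I (extChartAt I z.1).symm (extChartAt I z.1 z.1) := by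
    have := mdifferentiableWithinAt_extChartAt_symm (I := I) (mem_extChartAt_target (I := I) z.1)
    rwa [I.range_eq_univ, mdifferentiableWithinAt_univ] at this
  have h : mfderiv 𝓘(ℝ, E × ℝ) (I.prod 𝓘(ℝ)) (extChartAt (I.prod 𝓘(ℝ)) z).symm
      (extChartAt I z.1 z.1, z.2) =
      (mfderiv 𝓘(ℝ, E) I (extChartAt I z.1).symm (extChartAt I z.1 z.1)).prodMap
        (mfderiv 𝓘(ℝ) 𝓘(ℝ) (id : ℝ → ℝ) z.2) := by
    have hmap : ⇑(extChartAt (I.prod 𝓘(ℝ)) z).symm = Prod.map (extChartAt I z.1).symm id := by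
      rw [extChartAt_prod]; rfl
    rw [hmap, modelWithCornersSelf_prod, ← chartedSpaceSelf_prod]
    exact mfderiv_prodMap (p := (extChartAt I z.1 z.1, z.2)) hd
      (mdifferentiableAt_id (I := 𝓘(ℝ)))
  have hs : extChartAt (I.prod 𝓘(ℝ)) z z = (extChartAt I z.1 z.1, z.2) := by
    rw [extChartAt_prod]; rfl
  rw [hs, h]
  rfl

theorem vfLie_liftVF_fst [I.Boundaryless] [CompleteSpace E] {V W : VF I M} (hV : SmoothVF I V)
    (hW : SmoothVF I W) (a b : ℝ) (z : M × ℝ) :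
    (vfLie (I.prod 𝓘(ℝ)) (liftVF V a) (liftVF W b) z : E × ℝ).1 = vfLie I V W z.1 := by
  have hs : extChartAt (I.prod 𝓘(ℝ)) z z = (extChartAt I z.1 z.1, z.2) := by
    rw [extChartAt_prod]; rfl
  have hev (U : VF I M) (c : ℝ) : chartRep (I.prod 𝓘(ℝ)) z (liftVF U c)
      =ᶠ[𝓝 (extChartAt (I.prod 𝓘(ℝ)) z z)] fun e => (chartRep I z.1 U e.1, c) := by
    rw [hs]
    filter_upwards [continuous_fst.continuousAt.preimage_mem_nhds
      (extChartAt_target_mem_nhds (I := I) z.1)] with e he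
    exact chartRep_liftVF U c z he
  rw [vfLie_eq_chartRep, vfLie_eq_chartRep,
    (hev V a).lieBracket_vectorField_eq (𝕜 := ℝ) (hev W b), lieBracket_prodMk_const,
    mfderiv_extChartAt_symm_prod_fst, hs]
  · rw [hs]
    exact hV.differentiableAt_chartRep z.1
  · rw [hs]
    exact hW.differentiableAt_chartRep z.1

theorem dOfFun_swap (η : ∀ x : M, TangentSpace I x →ₗ[ℝ] ℝ) (V W : VF I M) (x : M) :
    dOfFun I (fun U x => η x (U x)) V W x = -dOfFun I (fun U x => η x (U x)) W V x := by
  simp only [dOfFun, vfLie_swap V W, map_neg]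
  ring

theorem exists_vfLie_notMem {D : TangentDist I M} {x : M}
    {S : Submodule ℝ (TangentSpace I x)}
    (hD : D x ≤ S) (h : ¬ derivedDist I D x ≤ S) :
    ∃ V W, IsSection I D V ∧ IsSection I D W ∧ vfLie I V W x ∉ S := by
  contrapose! h
  refine Submodule.span_le.2 ?_
  rintro v (⟨V, hV, rfl⟩ | ⟨V, W, hV, hW, rfl⟩)
  · exact hD (hV.2 x)
  · exact h V W hV hW

theorem vfLie_mem_derivedDist {D : TangentDist I M} {V W : VF I M} (hV : IsSection I D V)
    (hW : IsSection I D W) (x : M) : vfLie I V W x ∈ derivedDist I D x :=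
  Submodule.subset_span (Or.inr ⟨V, W, hV, hW, rfl⟩)

theorem vfLie_zero_left [I.Boundaryless] (W : VF I M) (x : M) : vfLie I 0 W x = 0 := by
  rw [vfLie_eq_mlieBracket, VectorField.mlieBracket_zero_left]
  rfl

/-- Nonvanishing of `(h ∧ Θ ∧ Θ)(e₀, …, e₄)` in dimension five, when `e₀` pairs nontrivially only with `e₁`
and `h` vanishes on `e₀, e₂, e₃`. -/
theorem sum_perm_wedge_ne_zero {h : Fin 5 → ℝ} {Θ : Fin 5 → Fin 5 → ℝ}
    (hΘ : ∀ i j, Θ i j = -Θ j i) (h0 : h 0 = 0) (h2 : h 2 = 0) (h3 : h 3 = 0) (h4 : h 4 ≠ 0)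
    (h02 : Θ 0 2 = 0) (h03 : Θ 0 3 = 0) (h04 : Θ 0 4 = 0) (h01 : Θ 0 1 ≠ 0) (h23 : Θ 2 3 ≠ 0) :
    ∑ σ : Equiv.Perm (Fin 5), ((Equiv.Perm.sign σ : ℤ) : ℝ) *
      (h (σ 0) * Θ (σ 1) (σ 2) * Θ (σ 3) (σ 4)) ≠ 0 := by
  let even : Finset (Fin 5 → Fin 5) := {![4, 0, 1, 2, 3], ![4, 1, 0, 3, 2], ![4, 2, 3, 0, 1],
    ![4, 3, 2, 1, 0]}
  let odd : Finset (Fin 5 → Fin 5) := {![4, 1, 0, 2, 3], ![4, 0, 1, 3, 2], ![4, 3, 2, 0, 1],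
    ![4, 2, 3, 1, 0]}
  let null : Finset (Fin 5 × Fin 5) := {(0, 2), (0, 3), (0, 4), (2, 0), (3, 0), (4, 0)}
  have key : ∀ σ : Equiv.Perm (Fin 5), (⇑σ ∈ even ∧ Equiv.Perm.sign σ = 1) ∨
      (⇑σ ∈ odd ∧ Equiv.Perm.sign σ = -1) ∨ (⇑σ ∉ even ∪ odd ∧
        (σ 0 ∈ ({0, 2, 3} : Finset (Fin 5)) ∨ (σ 1, σ 2) ∈ null ∨ (σ 3, σ 4) ∈ null)) := by
    decide +kernel
  have hzero : ∀ p ∈ null, Θ p.1 p.2 = 0 := by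
    simp [null, h02, h03, h04, hΘ 2 0, hΘ 3 0, hΘ 4 0]
  have hterm : ∀ σ : Equiv.Perm (Fin 5), ((Equiv.Perm.sign σ : ℤ) : ℝ) *
      (h (σ 0) * Θ (σ 1) (σ 2) * Θ (σ 3) (σ 4)) =
      if ⇑σ ∈ even ∪ odd then h 4 * Θ 0 1 * Θ 2 3 else 0 := by
    intro σ
    rcases key σ with ⟨hm, hs⟩ | ⟨hm, hs⟩ | ⟨hm, hs⟩
    · rw [if_pos (Finset.mem_union_left _ hm), hs]
      simp only [even, Finset.mem_insert, Finset.mem_singleton] at hm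
      rcases hm with hm | hm | hm | hm <;> rw [hm] <;>
        simp [hΘ 1 0, hΘ 3 2, mul_right_comm]
    · rw [if_pos (Finset.mem_union_right _ hm), hs]
      simp only [odd, Finset.mem_insert, Finset.mem_singleton] at hm
      rcases hm with hm | hm | hm | hm <;> rw [hm] <;>
        simp [hΘ 1 0, hΘ 3 2, mul_right_comm]
    · rw [if_neg hm]
      rcases hs with hs | hs | hs
      · have : h (σ 0) = 0 := by
          simp only [Finset.mem_insert, Finset.mem_singleton] at hs
          rcases hs with hs | hs | hs <;> rw [hs] <;> assumption
        simp [this]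
      · simp [hzero _ hs]
      · simp [hzero _ hs]
  have hne : (Finset.univ.filter fun σ : Equiv.Perm (Fin 5) => ⇑σ ∈ even ∪ odd).card ≠ 0 := by
    decide +kernel
  rw [Finset.sum_congr rfl fun σ _ => hterm σ, ← Finset.sum_filter, Finset.sum_const, nsmul_eq_mul]
  exact mul_ne_zero (Nat.cast_ne_zero.2 hne) (mul_ne_zero (mul_ne_zero h4 h01) h23)

/-- Derivative along `∂ₛ` of a function on `M × ℝ` which is affine in `s`. -/
theorem vderiv_liftVF_zero_one {f g : M → ℝ} (hf : SmoothFn I f) (hg : SmoothFn I g) (z : M × ℝ) :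
    vderiv (I.prod 𝓘(ℝ)) (liftVF 0 1) (fun z => f z.1 + z.2 * g z.1) z = g z.1 := by
  have hF : ContMDiff (I.prod 𝓘(ℝ)) 𝓘(ℝ) ∞ (fun z : M × ℝ => f z.1 + z.2 * g z.1) :=
    (hf.comp contMDiff_fst).add (contMDiff_snd.mul (hg.comp contMDiff_fst))
  have hcomp := mfderiv_comp (I := 𝓘(ℝ)) (I' := I.prod 𝓘(ℝ)) (I'' := 𝓘(ℝ)) z.2
    (g := fun z : M × ℝ => f z.1 + z.2 * g z.1) (f := fun s : ℝ => (z.1, s))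
    (hF.mdifferentiable (by simp) _)
    (mdifferentiableAt_const.prodMk mdifferentiableAt_id)
  rw [mfderiv_prod_right] at hcomp
  have hd : HasDerivAt (fun s : ℝ => f z.1 + s * g z.1) (g z.1) z.2 := by
    simpa using ((hasDerivAt_id z.2).mul_const (g z.1)).const_add (f z.1)
  have h1 := DFunLike.congr_fun hcomp (1 : ℝ)
  have h2 : mfderiv 𝓘(ℝ) 𝓘(ℝ) ((fun z : M × ℝ => f z.1 + z.2 * g z.1) ∘ fun s : ℝ => (z.1, s)) z.2
      (1 : ℝ) = g z.1 := by
    rw [mfderiv_eq_fderiv]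
    exact hd.deriv
  exact h1.symm.trans h2

theorem vderiv_zero_fun (V : VF I M) (x : M) : vderiv I V (fun _ => 0) x = 0 := by
  rw [vderiv, mfderiv_const]
  rfl

section Contactization

variable {M : Type*} [TopologicalSpace M] [ChartedSpace (EuclideanSpace ℝ (Fin 4)) M]
  [IsManifold (𝓡 4) (⊤ : ℕ∞) M]

theorem contactizationForm_apply (α β : OneForm (𝓡 4) M) (z : M × ℝ)
    (v : TangentSpace ((𝓡 4).prod 𝓘(ℝ)) z) :
    contactizationForm α β z v = β.val z.1 (v : EuclideanSpace ℝ (Fin 4) × ℝ).1 +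
      z.2 * α.val z.1 (v : EuclideanSpace ℝ (Fin 4) × ℝ).1 := rfl

theorem contactizationForm_liftVF (α β : OneForm (𝓡 4) M) (V : VF (𝓡 4) M) (c : ℝ) (z : M × ℝ) :
    contactizationForm α β z (liftVF V c z) =
      β.val z.1 (V z.1) + z.2 * α.val z.1 (V z.1) := rfl

/-- `dη(V + a ∂ₛ, W + b ∂ₛ)` in terms of the bracket of `V` and `W` on the base. -/
theorem dOfFun_contactizationForm_liftVF (α β : OneForm (𝓡 4) M) {V W : VF (𝓡 4) M}
    (hV : SmoothVF (𝓡 4) V) (hW : SmoothVF (𝓡 4) W) (a b : ℝ) (z : M × ℝ) :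
    dOfFun ((𝓡 4).prod 𝓘(ℝ)) (fun U x => contactizationForm α β x (U x))
      (liftVF V a) (liftVF W b) z =
    vderiv ((𝓡 4).prod 𝓘(ℝ)) (liftVF V a)
        (fun z => β.val z.1 (W z.1) + z.2 * α.val z.1 (W z.1)) z -
      vderiv ((𝓡 4).prod 𝓘(ℝ)) (liftVF W b)
        (fun z => β.val z.1 (V z.1) + z.2 * α.val z.1 (V z.1)) z -
      (β.val z.1 (vfLie (𝓡 4) V W z.1) + z.2 * α.val z.1 (vfLie (𝓡 4) V W z.1)) := by
  rw [← vfLie_liftVF_fst hV hW a b z]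
  rfl

theorem dOfFun_contactizationForm_vertical (α β : OneForm (𝓡 4) M) {W : VF (𝓡 4) M}
    (hW : SmoothVF (𝓡 4) W) (z : M × ℝ) :
    dOfFun ((𝓡 4).prod 𝓘(ℝ)) (fun U x => contactizationForm α β x (U x))
      (liftVF 0 1) (liftVF W 0) z = α.val z.1 (W z.1) := by
  rw [dOfFun_contactizationForm_liftVF α β smoothVF_zero hW, vfLie_zero_left,
    vderiv_liftVF_zero_one (β.smooth' W hW) (α.smooth' W hW)]
  simp [vderiv_zero_fun]

theorem dOfFun_contactizationForm_horizontal (α β : OneForm (𝓡 4) M) {D : TangentDist (𝓡 4) M}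
    (hforms : EngelDefiningForms (𝓡 4) D α β) {V W : VF (𝓡 4) M}
    (hV : IsSection (𝓡 4) D V) (hW : IsSection (𝓡 4) D W) (z : M × ℝ) :
    dOfFun ((𝓡 4).prod 𝓘(ℝ)) (fun U x => contactizationForm α β x (U x))
      (liftVF V 0) (liftVF W 0) z = -β.val z.1 (vfLie (𝓡 4) V W z.1) := by
  have hker {U : VF (𝓡 4) M} (hU : IsSection (𝓡 4) D U) (x : M) :
      α.val x (U x) = 0 ∧ β.val x (U x) = 0 := by
    simpa [hforms.1 x] using hU.2 x
  have hα : α.val z.1 (vfLie (𝓡 4) V W z.1) = 0 := by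
    simpa [hforms.2 z.1] using vfLie_mem_derivedDist hV hW z.1
  rw [dOfFun_contactizationForm_liftVF α β hV.1 hW.1, hα]
  simp [hker hV, hker hW, vderiv_zero_fun]

theorem isContactForm_contactizationForm {D : TangentDist (𝓡 4) M} {α β : OneForm (𝓡 4) M}
    (hD : IsEngel (𝓡 4) D) (hforms : EngelDefiningForms (𝓡 4) D α β) :
    IsContactForm ((𝓡 4).prod 𝓘(ℝ)) (contactizationForm α β) := by
  intro z
  have hfin (x : M) : FiniteDimensional ℝ (TangentSpace (𝓡 4) x) :=
    inferInstanceAs (FiniteDimensional ℝ (EuclideanSpace ℝ (Fin 4)))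
  have hdim : Module.finrank ℝ (TangentSpace (𝓡 4) z.1) = 4 :=
    finrank_euclideanSpace_fin (𝕜 := ℝ) (n := 4)
  obtain ⟨V, W, hV, hW, hVW⟩ := exists_vfLie_notMem (le_refl (D z.1))
    fun h => by
      have := Submodule.finrank_mono h
      rw [hD.1, hD.2.1] at this
      omega
  obtain ⟨A, B, hA, hB, hAB⟩ :=
    exists_vfLie_notMem (le_refl (derivedDist (𝓡 4) D z.1)) fun h => by
      have := Submodule.finrank_mono h
      rw [hD.2.1, hD.2.2, finrank_top, hdim] at this
      omega
  have hT := hV.1.vfLie hW.1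
  have hR := hA.1.vfLie hB.1
  have hker {U : VF (𝓡 4) M} (hU : IsSection (𝓡 4) D U) :
      α.val z.1 (U z.1) = 0 ∧ β.val z.1 (U z.1) = 0 := by
    simpa [hforms.1 z.1] using hU.2 z.1
  have hαT : α.val z.1 (vfLie (𝓡 4) V W z.1) = 0 := by
    simpa [hforms.2 z.1] using vfLie_mem_derivedDist hV hW z.1
  have hβT : β.val z.1 (vfLie (𝓡 4) V W z.1) ≠ 0 := fun h => hVW (by simp [hforms.1, hαT, h])
  have hαR : α.val z.1 (vfLie (𝓡 4) A B z.1) ≠ 0 := fun h => hAB (by simp [hforms.2, h])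
  let F : Fin 5 → VF ((𝓡 4).prod 𝓘(ℝ)) (M × ℝ) := ![liftVF 0 1, liftVF (vfLie (𝓡 4) A B) 0,
    liftVF V 0, liftVF W 0, liftVF (vfLie (𝓡 4) V W) 0]
  refine ⟨F, fun i => ?_, ?_⟩
  · fin_cases i
    exacts [smoothVF_zero.liftVF 1, hR.liftVF 0, hV.1.liftVF 0, hW.1.liftVF 0, hT.liftVF 0]
  · refine sum_perm_wedge_ne_zero (h := fun i => contactizationForm α β z (F i z))
      (Θ := fun i j => dOfFun ((𝓡 4).prod 𝓘(ℝ)) (fun U x => contactizationForm α β x (U x))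
        (F i) (F j) z)
      (fun i j => dOfFun_swap _ _ _ _) ?_ ?_ ?_ ?_ ?_ ?_ ?_ ?_ ?_
    · exact (contactizationForm_liftVF α β 0 1 z).trans (by simp)
    · exact (contactizationForm_liftVF α β V 0 z).trans (by simp [hker hV])
    · exact (contactizationForm_liftVF α β W 0 z).trans (by simp [hker hW])
    · exact ((contactizationForm_liftVF α β _ 0 z).trans (by simp [hαT])).trans_ne hβT
    · exact (dOfFun_contactizationForm_vertical α β hV.1 z).trans (hker hV).1
    · exact (dOfFun_contactizationForm_vertical α β hW.1 z).trans (hker hW).1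
    · exact (dOfFun_contactizationForm_vertical α β hT z).trans hαT
    · exact (dOfFun_contactizationForm_vertical α β hR z).trans_ne hαR
    · exact (dOfFun_contactizationForm_horizontal α β hforms hV hW z).trans_ne (neg_ne_zero.2 hβT)

theorem EngelDefiningForms.change {D : TangentDist (𝓡 4) M} {α β αt βt : OneForm (𝓡 4) M}
    (hforms : EngelDefiningForms (𝓡 4) D α β) {lam μ ν : M → ℝ} (hlam0 : ∀ x, lam x ≠ 0)
    (hμ0 : ∀ x, μ x ≠ 0) (hαt : ∀ x, αt.val x = lam x • α.val x)
    (hβt : ∀ x, βt.val x = ν x • α.val x + μ x • β.val x) :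
    EngelDefiningForms (𝓡 4) D αt βt := by
  refine ⟨fun x => ?_, fun x => ?_⟩
  · rw [hforms.1 x]
    ext v
    simp +contextual [hαt, hβt, hlam0, hμ0]
  · rw [hforms.2 x]
    ext v
    simp [hαt, hlam0]

/-- The fibrewise affine diffeomorphism `(p, s) ↦ (p, (μ(p) s − ν(p)) / λ(p))` of `M × ℝ`. -/
def fiberAffineDiffeomorph {lam μ ν : M → ℝ} (hlam : SmoothFn (𝓡 4) lam) (hμ : SmoothFn (𝓡 4) μ)
    (hν : SmoothFn (𝓡 4) ν) (hlam0 : ∀ x, lam x ≠ 0) (hμ0 : ∀ x, μ x ≠ 0) :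
    Diffeomorph ((𝓡 4).prod 𝓘(ℝ)) ((𝓡 4).prod 𝓘(ℝ)) (M × ℝ) (M × ℝ) (⊤ : ℕ∞) where
  toFun z := (z.1, (μ z.1 * z.2 - ν z.1) / lam z.1)
  invFun z := (z.1, (lam z.1 * z.2 + ν z.1) / μ z.1)
  left_inv z := by
    ext
    · rfl
    · have := hlam0 z.1
      have := hμ0 z.1
      simp only
      field_simp
      ring
  right_inv z := by
    ext
    · rfl
    · have := hlam0 z.1
      have := hμ0 z.1
      simp only
      field_simp
      ring
  contMDiff_toFun :=
    contMDiff_fst.prodMk ((((hμ.comp contMDiff_fst).mul contMDiff_snd).sub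
      (hν.comp contMDiff_fst)).div₀ (hlam.comp contMDiff_fst) fun z => hlam0 z.1)
  contMDiff_invFun :=
    contMDiff_fst.prodMk ((((hlam.comp contMDiff_fst).mul contMDiff_snd).add
      (hν.comp contMDiff_fst)).div₀ (hμ.comp contMDiff_fst) fun z => hμ0 z.1)

theorem mfderiv_fiberAffineDiffeomorph_fst {lam μ ν : M → ℝ} (hlam : SmoothFn (𝓡 4) lam)
    (hμ : SmoothFn (𝓡 4) μ) (hν : SmoothFn (𝓡 4) ν) (hlam0 : ∀ x, lam x ≠ 0)
    (hμ0 : ∀ x, μ x ≠ 0) (z : M × ℝ) (v : TangentSpace ((𝓡 4).prod 𝓘(ℝ)) z) :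
    (mfderiv ((𝓡 4).prod 𝓘(ℝ)) ((𝓡 4).prod 𝓘(ℝ))
      (fiberAffineDiffeomorph hlam hμ hν hlam0 hμ0) z v : EuclideanSpace ℝ (Fin 4) × ℝ).1 =
    (v : EuclideanSpace ℝ (Fin 4) × ℝ).1 := by
  have h := mfderiv_comp (I'' := 𝓡 4) z (g := (Prod.fst : M × ℝ → M)) mdifferentiableAt_fst
    ((fiberAffineDiffeomorph hlam hμ hν hlam0 hμ0).contMDiff.mdifferentiable (by simp) z)
  have hfst : (Prod.fst : M × ℝ → M) ∘ fiberAffineDiffeomorph hlam hμ hν hlam0 hμ0 = Prod.fst := rfl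
  rw [hfst, mfderiv_fst, mfderiv_fst] at h
  exact (DFunLike.congr_fun h v).symm

end Contactization

/-- The contactization `η = β + sα` of an Engel structure
`D = ker α∧β` is a contact form on `M × ℝ`, and for any other choice of defining forms
`α̃ = λα`, `β̃ = να + μβ` there is a contactomorphism
`ψ(p,s) = (p, (μ(p)s − ν(p))/λ(p))` with `ψ*η̃ = μη`. -/
theorem contactization_is_contact_and_well_defined {M : Type*} [TopologicalSpace M]
    [ChartedSpace (EuclideanSpace ℝ (Fin 4)) M] [IsManifold (𝓡 4) (⊤ : ℕ∞) M]
    (D : TangentDist (𝓡 4) M) (α β : OneForm (𝓡 4) M)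
    (hD : IsEngel (𝓡 4) D) (hforms : EngelDefiningForms (𝓡 4) D α β)
    (lam μ ν : M → ℝ) (hlam : SmoothFn (𝓡 4) lam) (hμ : SmoothFn (𝓡 4) μ)
    (hν : SmoothFn (𝓡 4) ν) (hlam0 : ∀ x, lam x ≠ 0) (hμ0 : ∀ x, μ x ≠ 0)
    (αt βt : OneForm (𝓡 4) M)
    (hαt : ∀ x, αt.val x = lam x • α.val x)
    (hβt : ∀ x, βt.val x = ν x • α.val x + μ x • β.val x) :
    IsContactForm ((𝓡 4).prod 𝓘(ℝ)) (contactizationForm α β) ∧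
    IsContactForm ((𝓡 4).prod 𝓘(ℝ)) (contactizationForm αt βt) ∧
    ∃ ψ : Diffeomorph ((𝓡 4).prod 𝓘(ℝ)) ((𝓡 4).prod 𝓘(ℝ)) (M × ℝ) (M × ℝ) (⊤ : ℕ∞),
      (∀ z : M × ℝ, ψ z = (z.1, (μ z.1 * z.2 - ν z.1) / lam z.1)) ∧
      ∀ (z : M × ℝ) (v : TangentSpace ((𝓡 4).prod 𝓘(ℝ)) z),
        contactizationForm αt βt (ψ z)
            (mfderiv ((𝓡 4).prod 𝓘(ℝ)) ((𝓡 4).prod 𝓘(ℝ)) (⇑ψ) z v)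
          = μ z.1 * contactizationForm α β z v := by
  refine ⟨isContactForm_contactizationForm hD hforms,
    isContactForm_contactizationForm hD (hforms.change hlam0 hμ0 hαt hβt),
    fiberAffineDiffeomorph hlam hμ hν hlam0 hμ0, fun z => rfl, fun z v => ?_⟩
  rw [contactizationForm_apply, contactizationForm_apply, mfderiv_fiberAffineDiffeomorph_fst]
  have key (u : TangentSpace (𝓡 4) z.1) :
      βt.val z.1 u + (μ z.1 * z.2 - ν z.1) / lam z.1 * αt.val z.1 u =
        μ z.1 * (β.val z.1 u + z.2 * α.val z.1 u) := by
    have := hlam0 z.1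
    simp only [hαt, hβt, LinearMap.add_apply, LinearMap.smul_apply, smul_eq_mul]
    field_simp
    ring
  exact key _

end
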